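/- Let (f_i)_{i∈I} be a family of proper lower semicontinuous convex functions from ℝⁿ to ℝ∪{+∞} such that the set 𝒜 := ⋃_{J∈𝓕(I)} Σ_{j∈J} epi f_j* is convex, and let x̄* ∈ ℝⁿ satisfy x̄* ∈ ri(⋃_{J∈𝓕(I)} Σ_{j∈J} dom f_j*). Then the infimum of the primal problem (RP_{x̄*}) is attained and min(RP_{x̄*}) = sup(RD_{x̄*}). -/

import Mathlib

open scoped Pointwise Topology
open Set Matrix

noncomputable section

variable {n : ℕ} {ι : Type*}

/-- Fenchel conjugate of `f : ℝⁿ → ℝ ∪ {+∞}` (modeled as `EReal`-valued). -/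
def fconj (f : (Fin n → ℝ) → EReal) (p : Fin n → ℝ) : EReal :=
  ⨆ x : Fin n → ℝ, ((p ⬝ᵥ x : ℝ) : EReal) - f x

/-- Effective domain. -/
def fdom (f : (Fin n → ℝ) → EReal) : Set (Fin n → ℝ) := {x | f x ≠ ⊤}

/-- Domain of the conjugate. -/
def fdomStar (f : (Fin n → ℝ) → EReal) : Set (Fin n → ℝ) := {p | fconj f p ≠ ⊤}

/-- Epigraph of the conjugate. -/
def fepiStar (f : (Fin n → ℝ) → EReal) : Set ((Fin n → ℝ) × ℝ) :=
  {q | fconj f q.1 ≤ (q.2 : EReal)}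

/-- Proper function: never `-∞`, not identically `+∞`. -/
def EProper {X : Type*} (f : X → EReal) : Prop := (∀ x, f x ≠ ⊥) ∧ ∃ x, f x ≠ ⊤

/-- Convexity of an extended-real-valued function, via its epigraph. -/
def EConvexFn {X : Type*} [AddCommGroup X] [Module ℝ X] (f : X → EReal) : Prop :=
  Convex ℝ {q : X × ℝ | f q.1 ≤ (q.2 : EReal)}

/-- Robust sum of a family of functions. -/
def rsum {X : Type*} (f : ι → X → EReal) (x : X) : EReal :=
  ⨆ (J : Finset ι) (_ : J.Nonempty), ∑ j ∈ J, f j x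

/-- Optimal value of the primal problem `(RP_p)`. -/
def fprimalVal (f : (Fin n → ℝ) → EReal) (p : Fin n → ℝ) : EReal :=
  ⨅ x : Fin n → ℝ, f x - ((p ⬝ᵥ x : ℝ) : EReal)

/-- Optimal solution set of the primal problem `(RP_p)`. -/
def fprimalSol (f : (Fin n → ℝ) → EReal) (p : Fin n → ℝ) : Set (Fin n → ℝ) :=
  {x | f x - ((p ⬝ᵥ x : ℝ) : EReal) = fprimalVal f p}

/-- Optimal value of the dual problem `(RD_p)`. -/
def fdualVal (f : ι → (Fin n → ℝ) → EReal) (p : Fin n → ℝ) : EReal :=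
  ⨆ (J : Finset ι) (_ : J.Nonempty) (xs : ι → Fin n → ℝ) (_ : ∑ j ∈ J, xs j = p),
    -∑ j ∈ J, fconj (f j) (xs j)

/-- A convex set in `E × ℝ` that lies above height `0` over the origin, and whose projection
absorbs the subspace containing it, lies above the graph of a linear functional. -/
theorem exists_linearMap_le_of_convex {E : Type*} [AddCommGroup E] [Module ℝ E]
    {A : Set (E × ℝ)} (hA : Convex ℝ A) (V : Submodule ℝ E) (hV : ∀ a ∈ A, a.1 ∈ V)
    (habs : ∀ v ∈ V, ∃ ε : ℝ, 0 < ε ∧ ∃ t : ℝ, (ε • v, t) ∈ A)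
    (h0 : ∀ t : ℝ, ((0 : E), t) ∈ A → 0 ≤ t) :
    ∃ g : E →ₗ[ℝ] ℝ, ∀ a ∈ A, g a.1 ≤ a.2 := by
  let B : Set (V × ℝ) := {b | ((b.1 : E), b.2) ∈ A}
  have hB : Convex ℝ B := hA.linear_preimage (V.subtype.prodMap LinearMap.id)
  obtain ⟨ε₀, -, t₀, ht₀⟩ := habs 0 V.zero_mem
  have hB0 : ((0 : V), t₀) ∈ B := by simpa [B] using ht₀
  let C : PointedCone ℝ (V × ℝ) :=
    { carrier := {w | ∃ c : ℝ, 0 ≤ c ∧ w ∈ c • B}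
      add_mem' := by
        rintro x y ⟨c, hc, hx⟩ ⟨d, hd, hy⟩
        exact ⟨c + d, add_nonneg hc hd, by
          rw [hB.add_smul hc hd]; exact Set.add_mem_add hx hy⟩
      zero_mem' := ⟨0, le_rfl, Set.mem_smul_set.2 ⟨_, hB0, zero_smul _ _⟩⟩
      smul_mem' := by
        rintro ⟨r, hr⟩ x ⟨c, hc, hx⟩
        refine ⟨r * c, mul_nonneg hr hc, ?_⟩
        rw [mul_smul]
        exact Set.smul_mem_smul_set hx }
  let φ : (V × ℝ) →ₗ.[ℝ] ℝ :=
    ⟨Submodule.prod ⊥ ⊤, (LinearMap.snd ℝ V ℝ).comp (Submodule.subtype _)⟩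
  obtain ⟨g, hgφ, hgC⟩ := riesz_extension C φ (by
      rintro ⟨⟨v, t⟩, hv⟩ ⟨c, hc, hx⟩
      obtain ⟨⟨w, s⟩, hw, hws⟩ := Set.mem_smul_set.1 hx
      have hv0 : v = 0 := by simpa using hv.1
      have h1 : c • w = 0 := by rw [← hv0]; exact congrArg Prod.fst hws
      have h2 : c * s = t := congrArg Prod.snd hws
      change 0 ≤ t
      rw [← h2]
      rcases smul_eq_zero.1 h1 with h | h
      · simp [h]
      · subst h
        exact mul_nonneg hc (h0 s (by simpa [B] using hw))) (by
      rintro ⟨v, s⟩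
      obtain ⟨ε, hε, t, ht⟩ := habs v v.2
      refine ⟨⟨(0, ε⁻¹ * t - s), by simp [φ]⟩, ε⁻¹, (inv_pos.2 hε).le, ?_⟩
      refine Set.mem_smul_set.2 ⟨(ε • v, t), by simpa [B] using ht, ?_⟩
      ext <;> simp [hε.ne'])
  obtain ⟨l, hl⟩ := (-(g.comp (LinearMap.inl ℝ V ℝ))).exists_extend
  refine ⟨l, fun a ha => ?_⟩
  have h1 : l a.1 = -g ((⟨a.1, hV a ha⟩ : V), (0 : ℝ)) := by
    simpa using LinearMap.congr_fun hl ⟨a.1, hV a ha⟩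
  have h2 : g ((0 : V), a.2) = a.2 := hgφ ⟨(0, a.2), by simp [φ]⟩
  have h3 : 0 ≤ g ((⟨a.1, hV a ha⟩ : V), a.2) :=
    hgC _ ⟨1, zero_le_one, by rw [one_smul]; exact ha⟩
  have h4 : ((⟨a.1, hV a ha⟩ : V), a.2) = ((⟨a.1, hV a ha⟩ : V), (0 : ℝ)) + ((0 : V), a.2) := by
    simp
  rw [h4, map_add, h2] at h3
  linarith

/-- From a point of the intrinsic interior one can move a little in every direction of the
affine span. -/
theorem exists_pos_add_smul_mem_of_mem_intrinsicInterior {E : Type*} [NormedAddCommGroup E]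
    [NormedSpace ℝ E] {D : Set E} {p : E} (hp : p ∈ intrinsicInterior ℝ D) {v : E}
    (hv : v ∈ (affineSpan ℝ D).direction) : ∃ ε : ℝ, 0 < ε ∧ p + ε • v ∈ D := by
  obtain ⟨y, hy, rfl⟩ := mem_intrinsicInterior.1 hp
  let γ : ℝ → affineSpan ℝ D := fun ε => ⟨ε • v +ᵥ (y : E),
    AffineSubspace.vadd_mem_of_mem_direction (Submodule.smul_mem _ _ hv) y.2⟩
  have hγ : Continuous γ := by
    refine Continuous.subtype_mk ?_ _
    simp only [vadd_eq_add]
    fun_prop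
  have h0 : γ 0 = y := by ext; simp [γ]
  have hmem : ∀ᶠ ε in 𝓝 (0 : ℝ), γ ε ∈ ((↑) ⁻¹' D : Set (affineSpan ℝ D)) :=
    hγ.continuousAt.eventually_mem (by rw [h0]; exact mem_interior_iff_mem_nhds.1 hy)
  obtain ⟨ε, hε, hpos⟩ := ((hmem.filter_mono nhdsWithin_le_nhds).and
    (self_mem_nhdsWithin : Set.Ioi (0 : ℝ) ∈ 𝓝[>] 0)).exists
  exact ⟨ε, hpos, by simpa [γ, add_comm] using hε⟩

/-- A sum of extended reals is bounded by `c` as soon as all sums of smaller reals are. -/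
theorem EReal.finset_sum_le_of_forall_lt {ι : Type*} (J : Finset ι) (a : ι → EReal)
    (ha : ∀ j ∈ J, a j ≠ ⊥) (c : ℝ)
    (h : ∀ r : ι → ℝ, (∀ j ∈ J, (r j : EReal) < a j) → ∑ j ∈ J, r j ≤ c) :
    ∑ j ∈ J, a j ≤ (c : EReal) := by
  classical
  induction J using Finset.induction_on generalizing c with
  | empty => simpa using h 0 (by simp)
  | insert i J hi ih =>
    rw [Finset.sum_insert hi]
    have key : ∀ r₀ : ℝ, (r₀ : EReal) < a i → ∑ j ∈ J, a j ≤ ((c - r₀ : ℝ) : EReal) := by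
      intro r₀ hr₀
      refine ih (fun j hj => ha j (Finset.mem_insert_of_mem hj)) _ fun r hr => ?_
      have := h (Function.update r i r₀) (by
        intro j hj
        rcases Finset.mem_insert.1 hj with rfl | hj
        · simpa using hr₀
        · rw [Function.update_of_ne (ne_of_mem_of_not_mem hj hi)]
          exact hr j hj)
      rw [Finset.sum_insert hi, Function.update_self,
        Finset.sum_congr rfl fun j hj =>
          Function.update_of_ne (ne_of_mem_of_not_mem hj hi) _ _] at this
      linarith
    refine EReal.add_le_of_forall_lt fun x hx y hy => ?_
    obtain ⟨r₀, hxr, hr⟩ := EReal.lt_iff_exists_real_btwn.1 hx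
    calc x + y ≤ r₀ + ((c - r₀ : ℝ) : EReal) := add_le_add hxr.le (hy.le.trans (key r₀ hr))
      _ = c := by rw [← EReal.coe_add]; simp

theorem fconj_le_of_forall_epigraph {f : (Fin n → ℝ) → EReal} (hbot : ∀ y, f y ≠ ⊥)
    {p : Fin n → ℝ} {c : ℝ} (h : ∀ y (t : ℝ), f y ≤ t → p ⬝ᵥ y - t ≤ c) : fconj f p ≤ c := by
  refine iSup_le fun y => ?_
  by_cases hy : f y = ⊤
  · simp [hy]
  · have ht : ((f y).toReal : EReal) = f y := EReal.coe_toReal hy (hbot y)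
    rw [← ht, ← EReal.coe_sub]
    exact EReal.coe_le_coe_iff.2 (h y _ ht.ge)

/-- A proper lower semicontinuous convex function is the supremum of its affine minorants
(Fenchel–Moreau). -/
theorem exists_fconj_le_of_lt {f : (Fin n → ℝ) → EReal} (hf : EProper f)
    (hlsc : LowerSemicontinuous f) (hconv : EConvexFn f) {x : Fin n → ℝ} {r : ℝ}
    (hr : (r : EReal) < f x) : ∃ p, fconj f p ≤ ((p ⬝ᵥ x - r : ℝ) : EReal) := by
  have hclosed : IsClosed {q : (Fin n → ℝ) × ℝ | f q.1 ≤ (q.2 : EReal)} :=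
    hlsc.isClosed_epigraph.preimage
      (f := fun q : (Fin n → ℝ) × ℝ => (q.1, (q.2 : EReal)))
      (continuous_fst.prodMk (continuous_coe_real_ereal.comp continuous_snd))
  have sep : ∀ (x : Fin n → ℝ) (r : ℝ), (r : EReal) < f x →
      ∃ (l : Fin n → ℝ) (s u : ℝ), 0 ≤ s ∧ l ⬝ᵥ x + s * r < u ∧
        ∀ y (t : ℝ), f y ≤ t → u < l ⬝ᵥ y + s * t := by
    intro x r hr
    obtain ⟨g, u, hu, hg⟩ := geometric_hahn_banach_point_closed hconv hclosed
      (x := (x, r)) (by simpa using hr)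
    let l := (dotProductEquiv ℝ (Fin n)).symm (g.toLinearMap.comp (LinearMap.inl ℝ _ ℝ))
    have hl : ∀ y t, g (y, t) = l ⬝ᵥ y + g (0, 1) * t := by
      intro y t
      have h1 : l ⬝ᵥ y = g (y, 0) := by
        change dotProductEquiv ℝ (Fin n) l y = _
        rw [LinearEquiv.apply_symm_apply]
        rfl
      have h2 : (y, t) = (y, (0 : ℝ)) + t • ((0 : Fin n → ℝ), (1 : ℝ)) := by simp
      rw [h2, map_add, map_smul, h1, smul_eq_mul, mul_comm]
    refine ⟨l, g (0, 1), u, ?_, by rw [← hl]; exact hu, fun y t hy => by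
      rw [← hl]; exact hg (y, t) hy⟩
    by_contra! hs
    obtain ⟨y, hy⟩ := hf.2
    have ht : ((f y).toReal : EReal) = f y := EReal.coe_toReal hy (hf.1 y)
    set t := (f y).toReal
    set s := g (0, 1)
    have h1 := hg (y, t + |(l ⬝ᵥ y + s * t - u) / s|) (by
      change f y ≤ ((t + |_| : ℝ) : EReal)
      rw [← ht]
      exact EReal.coe_le_coe_iff.2 (le_add_of_nonneg_right (abs_nonneg _)))
    rw [hl] at h1
    have h2 := neg_le_abs ((l ⬝ᵥ y + s * t - u) / s)
    have h3 : s * |(l ⬝ᵥ y + s * t - u) / s| ≤ s * -((l ⬝ᵥ y + s * t - u) / s) :=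
      mul_le_mul_of_nonpos_left h2 hs.le
    have h4 : s * -((l ⬝ᵥ y + s * t - u) / s) = -(l ⬝ᵥ y + s * t - u) := by
      rw [mul_neg, mul_div_cancel₀ _ hs.ne]
    rw [mul_add] at h1
    linarith
  have nonvert : ∀ (x : Fin n → ℝ) (r : ℝ) (l : Fin n → ℝ) (s u : ℝ), 0 < s →
      l ⬝ᵥ x + s * r < u → (∀ y (t : ℝ), f y ≤ t → u < l ⬝ᵥ y + s * t) →
      ∃ p : Fin n → ℝ, ∀ y (t : ℝ), f y ≤ t → p ⬝ᵥ y - t ≤ p ⬝ᵥ x - r := by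
    intro x r l s u hs h1 h2
    refine ⟨-(s⁻¹ • l), fun y t hy => ?_⟩
    have h3 := h1.trans (h2 y t hy)
    simp only [neg_dotProduct, smul_dotProduct, smul_eq_mul]
    have h4 := mul_le_mul_of_nonneg_left h3.le (inv_pos.2 hs).le
    rw [mul_add, mul_add, inv_mul_cancel_left₀ hs.ne', inv_mul_cancel_left₀ hs.ne'] at h4
    linarith
  suffices ∃ p : Fin n → ℝ, ∀ y (t : ℝ), f y ≤ t → p ⬝ᵥ y - t ≤ p ⬝ᵥ x - r by
    obtain ⟨p, hp⟩ := this
    exact ⟨p, fconj_le_of_forall_epigraph hf.1 hp⟩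
  obtain ⟨l, s, u, hs, h1, h2⟩ := sep x r hr
  rcases hs.lt_or_eq with hs | rfl
  · exact nonvert x r l s u hs h1 h2
  obtain ⟨z, hz⟩ := hf.2
  have hzt : ((f z).toReal : EReal) = f z := EReal.coe_toReal hz (hf.1 z)
  set t₀ := (f z).toReal
  obtain ⟨p, hp⟩ : ∃ p : Fin n → ℝ, ∀ y (t : ℝ), f y ≤ t → p ⬝ᵥ y - t ≤ p ⬝ᵥ z - (t₀ - 1) := by
    obtain ⟨l, s, u, hs, h1, h2⟩ := sep z (t₀ - 1) (by
      rw [← hzt]; exact EReal.coe_lt_coe_iff.2 (by linarith))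
    refine nonvert z _ l s u ?_ h1 h2
    have := h1.trans (h2 z t₀ hzt.ge)
    linarith
  have hgap : 0 < u - l ⬝ᵥ x := by linarith
  set c := p ⬝ᵥ z - (t₀ - 1) - p ⬝ᵥ x + r
  refine ⟨p - (|c| / (u - l ⬝ᵥ x)) • l, fun y t hy => ?_⟩
  have h3 : l ⬝ᵥ x + (u - l ⬝ᵥ x) ≤ l ⬝ᵥ y := by linarith [h2 y t hy]
  have h4 := mul_le_mul_of_nonneg_left h3 (div_nonneg (abs_nonneg c) hgap.le)
  rw [mul_add, div_mul_cancel₀ _ hgap.ne'] at h4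
  have h5 := hp y t hy
  have h6 := le_abs_self c
  simp only [sub_dotProduct, smul_dotProduct, smul_eq_mul]
  linarith

theorem mem_iUnion_sum_iff {M : Type*} [AddCommMonoid M] {S : ι → Set M} {a : M} :
    a ∈ ⋃ J ∈ {J : Finset ι | J.Nonempty}, ∑ j ∈ J, S j ↔
      ∃ J : Finset ι, J.Nonempty ∧ ∃ g : ι → M, (∀ j ∈ J, g j ∈ S j) ∧ ∑ j ∈ J, g j = a := by
  simp [Set.mem_finsetSum, Set.mem_iUnion]

theorem fconj_ne_bot {f : (Fin n → ℝ) → EReal} (hf : EProper f) (p : Fin n → ℝ) :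
    fconj f p ≠ ⊥ := by
  obtain ⟨y, hy⟩ := hf.2
  intro h
  have h1 : ((p ⬝ᵥ y : ℝ) : EReal) - f y ≤ ⊥ :=
    h ▸ le_iSup (fun y => ((p ⬝ᵥ y : ℝ) : EReal) - f y) y
  rw [← EReal.coe_toReal hy (hf.1 y), ← EReal.coe_sub] at h1
  exact EReal.coe_ne_bot _ (le_bot_iff.1 h1)

theorem EReal.coe_finset_sum {ι : Type*} (J : Finset ι) (a : ι → ℝ) :
    ((∑ j ∈ J, a j : ℝ) : EReal) = ∑ j ∈ J, (a j : EReal) := by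
  classical
  induction J using Finset.induction_on with
  | empty => simp
  | insert i J hi ih => rw [Finset.sum_insert hi, Finset.sum_insert hi, EReal.coe_add, ih]

theorem neg_le_fdualVal_of_mem {f : ι → (Fin n → ℝ) → EReal} {p : Fin n → ℝ} {t : ℝ}
    (h : (p, t) ∈ ⋃ J ∈ {J : Finset ι | J.Nonempty}, ∑ j ∈ J, fepiStar (f j)) :
    ((-t : ℝ) : EReal) ≤ fdualVal f p := by
  obtain ⟨J, hJ, g, hg, hsum⟩ := mem_iUnion_sum_iff.1 h
  have h1 : ∑ j ∈ J, (g j).1 = p := by rw [← Prod.fst_sum, hsum]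
  have h2 : ∑ j ∈ J, (g j).2 = t := by rw [← Prod.snd_sum, hsum]
  refine le_trans ?_ (le_iSup₂_of_le J hJ (le_iSup₂_of_le (fun j => (g j).1) h1 le_rfl))
  rw [EReal.coe_neg, EReal.neg_le_neg_iff, ← h2, EReal.coe_finset_sum]
  exact Finset.sum_le_sum hg

theorem EReal.finset_sum_ne_bot {ι : Type*} {J : Finset ι} {a : ι → EReal}
    (ha : ∀ j ∈ J, a j ≠ ⊥) : ∑ j ∈ J, a j ≠ ⊥ := by
  classical
  induction J using Finset.induction_on with
  | empty => simp
  | insert i J hi ih =>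
    rw [Finset.sum_insert hi]
    exact EReal.add_ne_bot_iff.2 ⟨ha i (Finset.mem_insert_self i J),
      ih fun j hj => ha j (Finset.mem_insert_of_mem hj)⟩

theorem EReal.finset_sum_eq_top {ι : Type*} {J : Finset ι} {a : ι → EReal}
    (ha : ∀ j ∈ J, a j ≠ ⊥) {i : ι} (hi : i ∈ J) (hai : a i = ⊤) : ∑ j ∈ J, a j = ⊤ := by
  classical
  rw [← Finset.add_sum_erase J a hi, hai]
  exact EReal.top_add_of_ne_bot
    (EReal.finset_sum_ne_bot fun j hj => ha j (Finset.mem_of_mem_erase hj))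

theorem fdualVal_le_of_forall_mem {f : ι → (Fin n → ℝ) → EReal} (hf : ∀ i, EProper (f i))
    {p : Fin n → ℝ} {c : EReal}
    (h : ∀ t : ℝ, (p, t) ∈ ⋃ J ∈ {J : Finset ι | J.Nonempty}, ∑ j ∈ J, fepiStar (f j) →
      ((-t : ℝ) : EReal) ≤ c) : fdualVal f p ≤ c := by
  refine iSup₂_le fun J hJ => iSup₂_le fun xs hxs => ?_
  by_cases htop : ∃ i ∈ J, fconj (f i) (xs i) = ⊤
  · obtain ⟨i, hi, hit⟩ := htop
    rw [EReal.finset_sum_eq_top (fun j _ => fconj_ne_bot (hf j) _) hi hit]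
    simp
  · push Not at htop
    have hreal : ∀ j ∈ J, ((fconj (f j) (xs j)).toReal : EReal) = fconj (f j) (xs j) :=
      fun j hj => EReal.coe_toReal (htop j hj) (fconj_ne_bot (hf j) _)
    rw [← Finset.sum_congr rfl hreal, ← EReal.coe_finset_sum, ← EReal.coe_neg]
    refine h _ (mem_iUnion_sum_iff.2 ⟨J, hJ,
      fun j => (xs j, (fconj (f j) (xs j)).toReal), fun j hj => (hreal j hj).ge, ?_⟩)
    ext1
    · rw [Prod.fst_sum, hxs]
    · rw [Prod.snd_sum]

theorem neg_le_rsum_sub_of_mem {f : ι → (Fin n → ℝ) → EReal} (hf : ∀ i, EProper (f i))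
    {p : Fin n → ℝ} {t : ℝ}
    (h : (p, t) ∈ ⋃ J ∈ {J : Finset ι | J.Nonempty}, ∑ j ∈ J, fepiStar (f j))
    (x : Fin n → ℝ) : ((-t : ℝ) : EReal) ≤ rsum f x - ((p ⬝ᵥ x : ℝ) : EReal) := by
  obtain ⟨J, hJ, g, hg, hsum⟩ := mem_iUnion_sum_iff.1 h
  have h1 : ∑ j ∈ J, (g j).1 = p := by rw [← Prod.fst_sum, hsum]
  have h2 : ∑ j ∈ J, (g j).2 = t := by rw [← Prod.snd_sum, hsum]
  rw [EReal.le_sub_iff_add_le (.inl (EReal.coe_ne_bot _)) (.inl (EReal.coe_ne_top _)),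
    ← EReal.coe_add]
  refine le_trans ?_ (le_iSup₂_of_le J hJ le_rfl)
  have h3 : -t + p ⬝ᵥ x = ∑ j ∈ J, ((g j).1 ⬝ᵥ x - (g j).2) := by
    rw [Finset.sum_sub_distrib, h2, ← h1, sum_dotProduct]
    ring
  rw [h3, EReal.coe_finset_sum]
  refine Finset.sum_le_sum fun j hj => ?_
  have h4 : (((g j).1 ⬝ᵥ x : ℝ) : EReal) - f j x ≤ ((g j).2 : EReal) :=
    (le_iSup (fun y => (((g j).1 ⬝ᵥ y : ℝ) : EReal) - f j y) x).trans (hg j hj)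
  by_cases hx : f j x = ⊤
  · simp [hx]
  · rw [← EReal.coe_toReal hx ((hf j).1 x)] at h4 ⊢
    rw [← EReal.coe_sub] at h4
    have h5 := EReal.coe_le_coe_iff.1 h4
    exact EReal.coe_le_coe_iff.2 (by linarith)

/-- Weak duality. -/
theorem fdualVal_le_fprimalVal {f : ι → (Fin n → ℝ) → EReal} (hf : ∀ i, EProper (f i))
    (p : Fin n → ℝ) : fdualVal f p ≤ fprimalVal (rsum f) p :=
  le_iInf fun x => fdualVal_le_of_forall_mem hf fun _ ht => neg_le_rsum_sub_of_mem hf ht x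

/-- Points of `⋃ Σ dom f_j*` are the projections of points of `⋃ Σ epi f_j*`. -/
theorem mem_iUnion_sum_fdomStar_iff {f : ι → (Fin n → ℝ) → EReal} (hf : ∀ i, EProper (f i))
    {q : Fin n → ℝ} :
    q ∈ ⋃ J ∈ {J : Finset ι | J.Nonempty}, ∑ j ∈ J, fdomStar (f j) ↔
      ∃ t : ℝ, (q, t) ∈ ⋃ J ∈ {J : Finset ι | J.Nonempty}, ∑ j ∈ J, fepiStar (f j) := by
  constructor
  · intro h
    obtain ⟨J, hJ, g, hg, rfl⟩ := mem_iUnion_sum_iff.1 h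
    refine ⟨∑ j ∈ J, (fconj (f j) (g j)).toReal, mem_iUnion_sum_iff.2 ⟨J, hJ,
      fun j => (g j, (fconj (f j) (g j)).toReal),
      fun j hj => (EReal.coe_toReal (hg j hj) (fconj_ne_bot (hf j) _)).ge, ?_⟩⟩
    ext1
    · rw [Prod.fst_sum]
    · rw [Prod.snd_sum]
  · rintro ⟨t, h⟩
    obtain ⟨J, hJ, g, hg, hsum⟩ := mem_iUnion_sum_iff.1 h
    refine mem_iUnion_sum_iff.2 ⟨J, hJ, fun j => (g j).1,
      fun j hj => ((show fconj (f j) (g j).1 ≤ ((g j).2 : EReal) from hg j hj).trans_lt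
        (EReal.coe_lt_top _)).ne, ?_⟩
    rw [← Prod.fst_sum, hsum]

/-- **Corollary 3.9 (Corollary 2.2).** Let `(f i)_{i ∈ ι} ⊆ Γ(ℝⁿ)` with
`𝒜 = ⋃_{J ∈ 𝓕(ι)} Σ_{j ∈ J} epi f_j*` convex and
`x̄* ∈ ri (⋃_{J ∈ 𝓕(ι)} Σ_{j ∈ J} dom f_j*)`. Then the primal infimum is attained and
`min(RP_{x̄*}) = sup(RD_{x̄*})`. -/
theorem primal_attainment_fin [Nonempty ι]
    (f : ι → (Fin n → ℝ) → EReal) (p : Fin n → ℝ)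
    (hproper : ∀ i, EProper (f i)) (hlsc : ∀ i, LowerSemicontinuous (f i))
    (hconv : ∀ i, EConvexFn (f i))
    (hA : Convex ℝ (⋃ J ∈ {J : Finset ι | J.Nonempty}, ∑ j ∈ J, fepiStar (f j)))
    (hri : p ∈ intrinsicInterior ℝ
      (⋃ J ∈ {J : Finset ι | J.Nonempty}, ∑ j ∈ J, fdomStar (f j))) :
    (fprimalSol (rsum f) p).Nonempty ∧ fprimalVal (rsum f) p = fdualVal f p := by
  have hweak := fdualVal_le_fprimalVal hproper p
  suffices ∃ x, rsum f x - ((p ⬝ᵥ x : ℝ) : EReal) ≤ fdualVal f p by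
    obtain ⟨x, hx⟩ := this
    have hle : fprimalVal (rsum f) p ≤ rsum f x - ((p ⬝ᵥ x : ℝ) : EReal) := iInf_le _ x
    exact ⟨⟨x, (hx.trans hweak).antisymm hle⟩, (hle.trans hx).antisymm hweak⟩
  by_cases htop : fdualVal f p = ⊤
  · exact ⟨0, htop ▸ le_top⟩
  obtain ⟨t₀, ht₀⟩ := (mem_iUnion_sum_fdomStar_iff hproper).1 (intrinsicInterior_subset hri)
  have hbot : fdualVal f p ≠ ⊥ := fun h =>
    EReal.coe_ne_bot _ (le_bot_iff.1 (h ▸ neg_le_fdualVal_of_mem ht₀))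
  obtain ⟨d, hd⟩ : ∃ d : ℝ, fdualVal f p = d := ⟨_, (EReal.coe_toReal htop hbot).symm⟩
  set A := ⋃ J ∈ {J : Finset ι | J.Nonempty}, ∑ j ∈ J, fepiStar (f j)
  set D := ⋃ J ∈ {J : Finset ι | J.Nonempty}, ∑ j ∈ J, fdomStar (f j)
  obtain ⟨g, hg⟩ := exists_linearMap_le_of_convex
    (hA.translate_preimage_right (p, -d)) (affineSpan ℝ D).direction (by
      rintro ⟨v, s⟩ hv
      have h1 : p + v ∈ D := (mem_iUnion_sum_fdomStar_iff hproper).2 ⟨-d + s, hv⟩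
      have h2 := AffineSubspace.vsub_mem_direction (subset_affineSpan ℝ D h1)
        (subset_affineSpan ℝ D (intrinsicInterior_subset hri))
      simpa using h2) (by
      intro v hv
      obtain ⟨ε, hε, hmem⟩ := exists_pos_add_smul_mem_of_mem_intrinsicInterior hri hv
      obtain ⟨t, ht⟩ := (mem_iUnion_sum_fdomStar_iff hproper).1 hmem
      exact ⟨ε, hε, t + d, by
        change (p + ε • v, -d + (t + d)) ∈ A
        rwa [show -d + (t + d) = t by ring]⟩) (by
      intro t ht
      have h1 : (p, -d + t) ∈ A := by simpa using ht
      have h2 := neg_le_fdualVal_of_mem h1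
      rw [hd, EReal.coe_le_coe_iff] at h2
      linarith)
  set x := (dotProductEquiv ℝ (Fin n)).symm g
  have hx : ∀ y, g y = y ⬝ᵥ x := by
    intro y
    rw [dotProduct_comm]
    exact (LinearMap.congr_fun ((dotProductEquiv ℝ (Fin n)).apply_symm_apply g) y).symm
  have hsub : ∀ q t, (q, t) ∈ A → q ⬝ᵥ x - p ⬝ᵥ x ≤ t + d := by
    intro q t hqt
    have := hg (q - p, t + d) (by
      change (p + (q - p), -d + (t + d)) ∈ A
      rwa [add_sub_cancel, show -d + (t + d) = t by ring])
    rwa [hx, sub_dotProduct] at this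
  refine ⟨x, ?_⟩
  rw [hd, EReal.sub_le_iff_le_add (.inl (EReal.coe_ne_bot _)) (.inl (EReal.coe_ne_top _)),
    ← EReal.coe_add]
  refine iSup₂_le fun J hJ => EReal.finset_sum_le_of_forall_lt J _
    (fun j _ => (hproper j).1 x) _ fun r hr => ?_
  choose! q hq using fun j (hj : j ∈ J) =>
    exists_fconj_le_of_lt (hproper j) (hlsc j) (hconv j) (hr j hj)
  have hmem : (∑ j ∈ J, q j, ∑ j ∈ J, (q j ⬝ᵥ x - r j)) ∈ A := by
    refine mem_iUnion_sum_iff.2 ⟨J, hJ, fun j => (q j, q j ⬝ᵥ x - r j), hq, ?_⟩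
    ext1
    · rw [Prod.fst_sum]
    · rw [Prod.snd_sum]
  have h1 := hsub _ _ hmem
  rw [sum_dotProduct, Finset.sum_sub_distrib] at h1
  linarith
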